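/- arXiv:2404.14235 — 9 statements merged into one kernel-verified Lean document; each statement's English description precedes it below -/
import Mathlib

section
/- Let n, σ be positive integers and let γ : Fin n → (ℕ → Fin σ) be lex-sorted and tail-closed. Suppose i : Fin n satisfies 1 ≤ i and lcp(γ (i−1), γ i) = k for some natural number k ≥ 1. Then there exists i' : Fin n with 1 ≤ i' such that lcp(γ (i'−1), γ i') = k − 1. (Lemma: every positive finite value in the reduced LCP array of a pseudoforest with distinct backward strings is preceded by the value one less somewhere in the array.) -/
/-- Strict lexicographic order on ω-strings over `Fin σ`. -/
def OmegaLt {σ : ℕ} (α β : ℕ → Fin σ) : Prop :=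
  ∃ k : ℕ, (∀ j, j < k → α j = β j) ∧ α k < β k

/-- Reflexive closure of the strict lexicographic order. -/
def OmegaLe {σ : ℕ} (α β : ℕ → Fin σ) : Prop := OmegaLt α β ∨ α = β

/-- Length of the longest common prefix: least `k` with `α k ≠ β k`. -/
noncomputable def lcp {σ : ℕ} (α β : ℕ → Fin σ) : ℕ := sInf {k | α k ≠ β k}

/-- Tail of an ω-string. -/
def tail {σ : ℕ} (α : ℕ → Fin σ) : ℕ → Fin σ := fun i => α (i + 1)

theorem lcp_of_aux {σ : ℕ} {α β : ℕ → Fin σ} {m : ℕ} (h : ∀ j, j < m → α j = β j)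
    (hm : α m ≠ β m) : lcp α β = m := by
  unfold lcp
  apply le_antisymm
  · exact Nat.sInf_le hm
  · by_contra hlt
    push Not at hlt
    have := Nat.sInf_mem (s := {k | α k ≠ β k}) ⟨m, hm⟩
    exact this (h _ hlt)

theorem sandwich_aux {σ : ℕ} {α β δ : ℕ → Fin σ} {m : ℕ} (h1 : OmegaLt α β) (h2 : OmegaLe β δ)
    (h : ∀ j, j < m → α j = δ j) : ∀ j, j < m → α j = β j := by
  rcases h2 with h2 | rfl
  · obtain ⟨p, hp, hp'⟩ := h1
    obtain ⟨q, hq, hq'⟩ := h2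
    intro j hj
    by_cases hpm : m ≤ p
    · exact hp j (by omega)
    exfalso
    push Not at hpm
    rcases lt_trichotomy q p with hqp | hqp | hqp
    · rw [← hp q hqp, h q (by omega)] at hq'
      exact lt_irrefl _ hq'
    · subst hqp
      rw [h q hpm] at hp'
      exact lt_irrefl _ (hp'.trans hq')
    · rw [h p hpm, hq p hqp] at hp'
      exact lt_irrefl _ hp'
  · exact h

theorem fin_pred_aux (n : ℕ) [NeZero n] (c : ℕ) (h : c + 1 < n) :
    (1 : Fin n) ≤ ⟨c + 1, h⟩ ∧ (⟨c + 1, h⟩ : Fin n) - 1 = ⟨c, by omega⟩ := by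
  obtain ⟨m, rfl⟩ : ∃ m, n = m + 2 := ⟨n - 2, by omega⟩
  have h2 : (⟨c + 1, h⟩ : Fin (m + 2)) = ⟨c, by omega⟩ + 1 := by
    ext
    simp [Fin.val_add, Nat.mod_eq_of_lt h]
  constructor
  · rw [Fin.le_def]; simp
  · rw [h2]; simp

/-- Every positive finite value in the reduced LCP array of a lex-sorted, tail-closed
family of ω-strings is preceded by the value one less somewhere in the array. -/
theorem stmt_0 (n σ : ℕ) [NeZero n] [NeZero σ]
    (γ : Fin n → (ℕ → Fin σ))
    (hsort : ∀ i j : Fin n, i < j → OmegaLt (γ i) (γ j))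
    (htail : ∀ i : Fin n, ∃ j : Fin n, γ j = tail (γ i))
    (i : Fin n) (hi : 1 ≤ i) (k : ℕ) (hk : 1 ≤ k)
    (hlcp : lcp (γ (i - 1)) (γ i) = k) :
    ∃ i' : Fin n, 1 ≤ i' ∧ lcp (γ (i' - 1)) (γ i') = k - 1 := by
  have hne : γ (i - 1) ≠ γ i := by
    intro h
    rw [h] at hlcp
    simp [lcp] at hlcp
    omega
  have hn : 1 < n := by
    by_contra hn
    have : n = 1 := by have := NeZero.ne n; omega
    subst this
    exact hne (congrArg γ (Subsingleton.elim _ _))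
  have hi0 : 0 < i.val := by
    rw [Fin.le_def] at hi
    rw [Fin.val_one', Nat.mod_eq_of_lt hn] at hi
    omega
  have hlt : i - 1 < i := by
    obtain ⟨c, hc⟩ : ∃ c, i.val = c + 1 := ⟨i.val - 1, by omega⟩
    have h' : c + 1 < n := by have := i.isLt; omega
    have : i = ⟨c + 1, h'⟩ := Fin.ext hc
    rw [this, (fin_pred_aux n c h').2, Fin.lt_def]
    simp
  obtain ⟨p, hp, hp'⟩ := hsort _ _ hlt
  have hpk : p = k := by rw [← hlcp, lcp_of_aux hp hp'.ne]
  subst hpk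
  obtain ⟨m, rfl⟩ : ∃ m, p = m + 1 := ⟨p - 1, by omega⟩
  obtain ⟨a, ha⟩ := htail (i - 1)
  obtain ⟨b, hb⟩ := htail i
  have hab : ∀ j, j < m → γ a j = γ b j := by
    intro j hj
    rw [ha, hb]
    exact hp (j + 1) (by omega)
  have habm : γ a m < γ b m := by
    rw [ha, hb]; exact hp'
  have hltab : a < b := by
    rcases lt_trichotomy a b with h | h | h
    · exact h
    · subst h; exact absurd habm (lt_irrefl _)
    · obtain ⟨q, hq, hq'⟩ := hsort _ _ h
      exfalso
      rcases lt_trichotomy q m with h1 | h1 | h1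
      · rw [hab q h1] at hq'; exact lt_irrefl _ hq'
      · subst h1; exact lt_irrefl _ (hq'.trans habm)
      · rw [hq m h1] at habm; exact lt_irrefl _ habm
  -- find the first position leaving the block of `a`
  have hex : ∃ d, ∃ h : a.val + d < n, ¬ ∀ j, j < m + 1 → γ a j = γ ⟨a.val + d, h⟩ j := by
    rw [Fin.lt_def] at hltab
    refine ⟨b.val - a.val, by have := b.isLt; omega, ?_⟩
    have hbb : (⟨a.val + (b.val - a.val), by have := b.isLt; omega⟩ : Fin n) = b :=
      Fin.ext (by simp; omega)
    rw [hbb]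
    intro h
    exact habm.ne (h m (by omega))
  classical
  have hbd : ∀ h : a.val + (b.val - a.val) < n,
      ¬ ∀ j, j < m + 1 → γ a j = γ ⟨a.val + (b.val - a.val), h⟩ j := by
    intro h0
    rw [Fin.lt_def] at hltab
    have hbb : (⟨a.val + (b.val - a.val), h0⟩ : Fin n) = b :=
      Fin.ext (by simp; omega)
    rw [hbb]
    intro h
    exact habm.ne (h m (by omega))
  have hdle : Nat.find hex ≤ b.val - a.val := by
    apply Nat.find_min'
    rw [Fin.lt_def] at hltab
    have h0 : a.val + (b.val - a.val) < n := by have := b.isLt; omega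
    exact ⟨h0, hbd h0⟩
  obtain ⟨hd1, hd2⟩ := Nat.find_spec hex
  have hmin := fun e => @Nat.find_min _ _ hex e
  generalize Nat.find hex = d at *
  rcases d with _ | d
  · exact absurd (fun j _ => rfl) hd2
  have hdn : a.val + d < n := by omega
  have hc : ∀ j, j < m + 1 → γ a j = γ ⟨a.val + d, hdn⟩ j := by
    by_contra h
    exact hmin d (by omega) ⟨hdn, h⟩
  obtain ⟨g1, g2⟩ := fin_pred_aux n (a.val + d) hd1
  refine ⟨⟨a.val + d + 1, hd1⟩, g1, ?_⟩
  rw [g2]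
  have hs : ∀ j, j < m → γ ⟨a.val + d, hdn⟩ j = γ ⟨a.val + d + 1, hd1⟩ j := by
    apply sandwich_aux (δ := γ b)
    · apply hsort
      rw [Fin.lt_def]; simp
    · rw [Fin.lt_def] at hltab
      rcases Nat.lt_or_ge (a.val + d + 1) b.val with h | h
      · exact Or.inl (hsort _ _ (by rw [Fin.lt_def]; exact h))
      · exact Or.inr (congrArg γ (Fin.ext (by simp; omega)))
    · intro j hj
      rw [← hc j (by omega), hab j hj]
  apply lcp_of_aux hs
  intro hm
  apply hd2
  intro j hj
  rw [hc j hj]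
  rcases Nat.lt_or_ge j m with h | h
  · exact hs j h
  · obtain rfl : j = m := by omega
    exact hm
end

section
/- Let n, σ be positive integers, let γ : Fin n → (ℕ → Fin σ) be lex-sorted and tail-closed, and let p : Fin n → Fin n be a function satisfying γ (p i) = tail (γ i) for all i (such p exists by tail-closedness and is unique because a lex-sorted family is injective). If i : Fin n satisfies 1 ≤ i and lcp(γ (i−1), γ i) ≥ 1, then p (i−1) < p i. -/
/-- If consecutive strings in a lex-sorted tail-closed family share their first character,
then the positions of their tails are in the same strict order. -/
theorem stmt_1 (n σ : ℕ) [NeZero n] [NeZero σ]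
    (γ : Fin n → (ℕ → Fin σ))
    (hsort : ∀ i j : Fin n, i < j → OmegaLt (γ i) (γ j))
    (htail : ∀ i : Fin n, ∃ j : Fin n, γ j = tail (γ i))
    (p : Fin n → Fin n) (hp : ∀ i : Fin n, γ (p i) = tail (γ i))
    (i : Fin n) (hi : 1 ≤ i) (hlcp : 1 ≤ lcp (γ (i - 1)) (γ i)) :
    p (i - 1) < p i := by
  have hne : i - 1 ≠ i := by
    intro h
    rw [h] at hlcp
    simp [lcp] at hlcp
  have hle : i - 1 ≤ i := by
    rw [Fin.le_def, Fin.sub_val_of_le hi]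
    omega
  obtain ⟨k, hk, hlt⟩ := hsort _ _ (lt_of_le_of_ne hle hne)
  have h0 : γ (i - 1) 0 = γ i 0 := by
    by_contra h
    have : lcp (γ (i - 1)) (γ i) ≤ 0 := Nat.sInf_le h
    omega
  obtain _ | k := k
  · rw [h0] at hlt
    exact absurd hlt (lt_irrefl _)
  have e1 : ∀ j, γ (p (i - 1)) j = γ (i - 1) (j + 1) := fun j => by rw [hp]; rfl
  have e2 : ∀ j, γ (p i) j = γ i (j + 1) := fun j => by rw [hp]; rfl
  by_contra hcon
  rcases (not_lt.mp hcon).eq_or_lt with h | h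
  · rw [← e1, ← e2, h] at hlt
    exact absurd hlt (lt_irrefl _)
  · obtain ⟨m, hm, hmlt⟩ := hsort _ _ h
    rw [e1, e2] at hmlt
    rcases lt_trichotomy m k with hmk | hmk | hmk
    · rw [hk (m + 1) (by omega)] at hmlt
      exact absurd hmlt (lt_irrefl _)
    · subst hmk
      exact absurd hmlt (lt_asymm hlt)
    · have := hm k hmk
      rw [e1, e2] at this
      rw [this] at hlt
      exact absurd hlt (lt_irrefl _)
end

section
/- Let n, σ be positive integers, let γ : Fin n → (ℕ → Fin σ) be lex-sorted and tail-closed, and let p : Fin n → Fin n satisfy γ (p i) = tail (γ i) for all i. If i : Fin n satisfies 1 ≤ i and lcp(γ (i−1), γ i) ≥ 1, then p (i−1) < p i and lcp(γ (i−1), γ i) = 1 + min { lcp(γ (t−1), γ t) : t : Fin n, p (i−1) < t ≤ p i } (the minimum is over a nonempty finite set since p (i−1) < p i). -/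
theorem lcp_eq_of {σ : ℕ} {α β : ℕ → Fin σ} {k : ℕ} (h : ∀ j, j < k → α j = β j)
    (hk : α k ≠ β k) : lcp α β = k := by
  unfold lcp
  apply le_antisymm
  · exact Nat.sInf_le hk
  · apply le_csInf ⟨k, hk⟩
    intro b hb
    by_contra hlt
    exact hb (h b (by omega))

theorem OmegaLt_spec {σ : ℕ} {α β : ℕ → Fin σ} (h : OmegaLt α β) :
    (∀ j, j < lcp α β → α j = β j) ∧ α (lcp α β) < β (lcp α β) := by
  obtain ⟨k, h1, h2⟩ := h
  rw [lcp_eq_of h1 h2.ne]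
  exact ⟨h1, h2⟩

theorem OmegaLt_asymm {σ : ℕ} {α β : ℕ → Fin σ} (h : OmegaLt α β) (h' : OmegaLt β α) : False := by
  obtain ⟨k, h1, h2⟩ := h
  obtain ⟨l, h3, h4⟩ := h'
  rcases lt_trichotomy k l with hl | hl | hl
  · exact absurd (h3 k hl) h2.ne'
  · subst hl; exact lt_asymm h2 h4
  · exact absurd (h1 l hl) h4.ne'

theorem Omega_squeeze {σ : ℕ} {α β δ : ℕ → Fin σ} {m : ℕ} (h : OmegaLt α β) (h' : OmegaLt β δ)
    (hm : ∀ j, j < m → α j = δ j) : ∀ j, j < m → α j = β j := by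
  obtain ⟨k, h1, h2⟩ := h
  obtain ⟨l, h3, h4⟩ := h'
  intro j hj
  by_cases hk : j < k
  · exact h1 j hk
  exfalso
  have hkm := hm k (by omega)
  rcases lt_trichotomy k l with hl | hl | hl
  · rw [h3 k hl, ← hkm] at h2; exact lt_irrefl _ h2
  · subst hl; rw [← hkm] at h4; exact lt_asymm h2 h4
  · rw [← h1 l hl, hm l (by omega)] at h4; exact lt_irrefl _ h4

theorem fin_sub_one_val {n : ℕ} [NeZero n] (t : Fin n) (ht : 0 < t.val) :
    (t - 1).val = t.val - 1 := by
  obtain ⟨m, rfl⟩ : ∃ m, n = m + 2 := ⟨n - 2, by have := t.isLt; omega⟩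
  rw [Fin.val_sub_one_of_ne_zero]
  intro h
  simp [h] at ht

/-- The LCP recurrence: if consecutive strings share their first character, then their LCP is
one plus the minimum LCP over the interval between the positions of their tails. -/
theorem stmt_2 (n σ : ℕ) [NeZero n] [NeZero σ]
    (γ : Fin n → (ℕ → Fin σ))
    (hsort : ∀ i j : Fin n, i < j → OmegaLt (γ i) (γ j))
    (htail : ∀ i : Fin n, ∃ j : Fin n, γ j = tail (γ i))
    (p : Fin n → Fin n) (hp : ∀ i : Fin n, γ (p i) = tail (γ i))
    (i : Fin n) (hi : 1 ≤ i) (hlcp : 1 ≤ lcp (γ (i - 1)) (γ i)) :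
    p (i - 1) < p i ∧
    lcp (γ (i - 1)) (γ i) =
      1 + sInf {d : ℕ | ∃ t : Fin n, p (i - 1) < t ∧ t ≤ p i ∧ d = lcp (γ (t - 1)) (γ t)} := by
  have hi0 : 0 < i.val := by
    rcases Nat.eq_zero_or_pos i.val with h | h
    · exfalso
      have hn : n = 1 := by
        by_contra hne
        have : 0 < n := Nat.pos_of_ne_zero (NeZero.ne n)
        obtain ⟨m, rfl⟩ : ∃ m, n = m + 2 := ⟨n - 2, by omega⟩
        have h1 := Fin.le_def.1 hi
        simp [h] at h1
      subst hn
      have : i - 1 = i := Subsingleton.elim _ _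
      rw [this] at hlcp
      simp [lcp] at hlcp
    · exact h
  have hlt : i - 1 < i := by
    rw [Fin.lt_def, fin_sub_one_val i hi0]; omega
  obtain ⟨h1, h2⟩ := OmegaLt_spec (hsort _ _ hlt)
  obtain ⟨m, hm⟩ : ∃ m, lcp (γ (i - 1)) (γ i) = m + 1 := ⟨_, (Nat.sub_add_cancel hlcp).symm⟩
  rw [hm] at h1 h2 ⊢
  generalize ha : p (i - 1) = a
  generalize hb : p i = b
  have e1 : ∀ j, j < m → γ a j = γ b j := by
    intro j hj
    rw [← ha, ← hb, hp, hp]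
    exact h1 (j + 1) (by omega)
  have e2 : γ a m < γ b m := by
    rw [← ha, ← hb, hp, hp]
    exact h2
  have hab : a < b := by
    rcases lt_trichotomy a b with h | h | h
    · exact h
    · subst h; exact absurd e2 (lt_irrefl _)
    · exact (OmegaLt_asymm ⟨m, e1, e2⟩ (hsort _ _ h)).elim
  refine ⟨hab, ?_⟩
  have sq : ∀ t, a ≤ t → t ≤ b → ∀ j, j < m → γ a j = γ t j := by
    intro t h3 h4
    rcases h3.eq_or_lt with h | h
    · subst h; intros; rfl
    rcases h4.eq_or_lt with h' | h'
    · subst h'; exact e1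
    exact Omega_squeeze (hsort _ _ h) (hsort _ _ h') e1
  have step : ∀ t : Fin n, a < t → a ≤ t - 1 ∧ t - 1 < t := by
    intro t h
    have h' := Fin.lt_def.1 h
    have := fin_sub_one_val t (by omega)
    rw [Fin.lt_def, Fin.le_def]; omega
  have lb : ∀ t, a < t → t ≤ b → m ≤ lcp (γ (t - 1)) (γ t) := by
    intro t h3 h4
    obtain ⟨h5, h6⟩ := step t h3
    by_contra hc
    push Not at hc
    have h7 := (OmegaLt_spec (hsort _ _ h6)).2
    rw [← sq _ h5 (h6.le.trans h4) _ hc, ← sq _ h3.le h4 _ hc] at h7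
    exact lt_irrefl _ h7
  have ub : ∃ t, a < t ∧ t ≤ b ∧ lcp (γ (t - 1)) (γ t) ≤ m := by
    by_contra! hc
    have key : ∀ d : ℕ, ∀ t : Fin n, t.val = a.val + d → t ≤ b → γ t m = γ a m := by
      intro d
      induction d with
      | zero => intro t h _; rw [Fin.ext (a := t) (b := a) (by simpa using h)]
      | succ d ih =>
        intro t h h4
        have h3 : a < t := by rw [Fin.lt_def]; omega
        obtain ⟨h5, h6⟩ := step t h3
        rw [← (OmegaLt_spec (hsort _ _ h6)).1 m (hc t h3 h4)]
        apply ih _ _ (h6.le.trans h4)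
        rw [fin_sub_one_val t (by omega)]; omega
    have := Fin.lt_def.1 hab
    exact e2.ne' (key (b.val - a.val) b (by omega) le_rfl)
  obtain ⟨t, h3, h4, h5⟩ := ub
  rw [add_comm m 1]
  congr 1
  apply le_antisymm
  · refine le_csInf ⟨_, t, h3, h4, rfl⟩ ?_
    rintro d ⟨s, h6, h7, rfl⟩
    exact lb s h6 h7
  · refine le_trans (Nat.sInf_le ?_) h5
    exact ⟨t, h3, h4, rfl⟩
end

section
/- Let σ be a positive integer and let S be a set of ω-strings over Fin σ closed under tail (α ∈ S → tail α ∈ S). Consider the labeled graph with vertex set S and edge set E = {(tail α, α, α 0) : α ∈ S}. Then the lexicographic order on S is a Wheeler order for this graph, namely: (Axiom 1) every node of the graph has an incoming edge, so there are no in-degree-0 nodes and Axiom 1 holds vacuously; (Axiom 2) for all α, β ∈ S, if α ≺ β then the labels of their incoming edges satisfy α 0 ≤ β 0; (Axiom 3) for all α, β ∈ S with α 0 = β 0, if α ≺ β then tail α ≼ tail β, i.e., the start node of the edge entering α precedes (weakly) the start node of the edge entering β in lexicographic order. -/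
/-- The edge set of the graph on a tail-closed set `S` of ω-strings:
each node `α` has the unique incoming edge `(tail α, α, α 0)`. -/
def EdgeSet {σ : ℕ} (S : Set (ℕ → Fin σ)) : Set ((ℕ → Fin σ) × (ℕ → Fin σ) × Fin σ) :=
  {e | ∃ α ∈ S, e = (tail α, α, α 0)}

/-- The lexicographic order on a tail-closed set of ω-strings is a Wheeler order
for the graph with edges `(tail α, α, α 0)`. -/
theorem stmt_3 (σ : ℕ) [NeZero σ]
    (S : Set (ℕ → Fin σ)) (hS : ∀ α ∈ S, tail α ∈ S) :
    -- Axiom 1 (vacuous): every node has an incoming edge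
    (∀ α ∈ S, ∃ β c, (β, α, c) ∈ EdgeSet S) ∧
    -- Axiom 2
    (∀ e ∈ EdgeSet S, ∀ e' ∈ EdgeSet S, OmegaLt e.2.1 e'.2.1 → e.2.2 ≤ e'.2.2) ∧
    -- Axiom 3
    (∀ e ∈ EdgeSet S, ∀ e' ∈ EdgeSet S, e.2.2 = e'.2.2 → OmegaLt e.2.1 e'.2.1 →
      OmegaLe e.1 e'.1) := by
  refine ⟨fun α h => ⟨tail α, α 0, α, h, rfl⟩, ?_, ?_⟩
  · rintro _ ⟨α, _, rfl⟩ _ ⟨β, _, rfl⟩ ⟨k, hk, hlt⟩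
    cases k with
    | zero => exact hlt.le
    | succ k => exact (hk 0 (Nat.succ_pos k)).le
  · rintro _ ⟨α, _, rfl⟩ _ ⟨β, _, rfl⟩ h0 ⟨k, hk, hlt⟩
    cases k with
    | zero => exact absurd h0 hlt.ne
    | succ k => exact Or.inl ⟨k, fun j hj => hk (j + 1) (Nat.succ_lt_succ hj), hlt⟩
end

section
/- Let E be a labeled graph on node set Fin n over alphabet Fin σ in which every node has at least one incoming edge. Fix a node u and suppose γ is a greatest lower bound of I_u with respect to the lexicographic order (IsGLB of I_u over the linear order whose strict part is ≺). Then there exists a node v such that (v, u, γ 0) ∈ E and the tail of γ is a greatest lower bound of I_v. -/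
/-- The set of ω-strings labeling infinite backward walks from node `u`. -/
def Iset {n σ : ℕ} (E : Set (Fin n × Fin n × Fin σ)) (u : Fin n) : Set (ℕ → Fin σ) :=
  {γ | ∃ f : ℕ → Fin n, f 0 = u ∧ ∀ i : ℕ, (f (i + 1), f i, γ i) ∈ E}

/-- `γ` is a greatest lower bound of `S` w.r.t. the lexicographic order. -/
def IsGLBOmega {σ : ℕ} (S : Set (ℕ → Fin σ)) (γ : ℕ → Fin σ) : Prop :=
  (∀ δ ∈ S, OmegaLe γ δ) ∧ ∀ β : ℕ → Fin σ, (∀ δ ∈ S, OmegaLe β δ) → OmegaLe β γ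

theorem omegaLt_iff {σ : ℕ} (α β : ℕ → Fin σ) : OmegaLt α β ↔ toLex α < toLex β := Iff.rfl

theorem omegaLe_iff {σ : ℕ} (α β : ℕ → Fin σ) : OmegaLe α β ↔ toLex α ≤ toLex β := by
  rw [le_iff_lt_or_eq]; exact Iff.rfl

def pre {σ : ℕ} (S : Set (ℕ → Fin σ)) : ℕ → Set (ℕ → Fin σ)
  | 0 => S
  | k + 1 => {δ | δ ∈ pre S k ∧ ∀ δ' ∈ pre S k, δ k ≤ δ' k}

theorem pre_nonempty {σ : ℕ} (S : Set (ℕ → Fin σ)) (hS : S.Nonempty) (k : ℕ) :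
    (pre S k).Nonempty := by
  induction k with
  | zero => exact hS
  | succ k ih =>
    obtain ⟨d, hd⟩ := ih
    obtain ⟨c, ⟨δ, hδ, rfl⟩, hc⟩ := Set.exists_min_image ((fun δ => δ k) '' pre S k) id
      (Set.toFinite _) ⟨_, d, hd, rfl⟩
    exact ⟨δ, hδ, fun δ' h' => hc _ ⟨δ', h', rfl⟩⟩

theorem exists_first {σ : ℕ} {α β : ℕ → Fin σ} (h : α ≠ β) :
    ∃ k, (∀ j, j < k → α j = β j) ∧ α k ≠ β k := by
  classical
  have h' : ∃ k, α k ≠ β k := Function.ne_iff.mp h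
  exact ⟨Nat.find h', fun j hj => not_not.mp (Nat.find_min h' hj), Nat.find_spec h'⟩

theorem exists_glb {σ : ℕ} (S : Set (ℕ → Fin σ)) (hS : S.Nonempty) :
    ∃ g, IsGLBOmega S g := by
  choose d hd using fun k => pre_nonempty S hS k
  have hsub : ∀ k, pre S k ⊆ S := by
    intro k
    induction k with
    | zero => exact subset_rfl
    | succ k ih => exact fun x hx => ih hx.1
  have key : ∀ k δ, δ ∈ S → (δ ∈ pre S k ↔ ∀ j, j < k → δ j = d (j + 1) j) := by
    intro k
    induction k with
    | zero => intro δ h; simp [pre, h]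
    | succ k ih =>
      intro δ h
      constructor
      · intro hk j hj
        rcases Nat.lt_succ_iff_lt_or_eq.mp hj with hj | rfl
        · exact (ih δ h).1 hk.1 j hj
        · exact le_antisymm (hk.2 _ (hd (j + 1)).1) ((hd (j + 1)).2 _ hk.1)
      · intro hj
        refine ⟨(ih δ h).2 fun j hjk => hj j (by omega), fun δ' h' => ?_⟩
        rw [hj k (by omega)]
        exact (hd (k + 1)).2 _ h'
  refine ⟨fun k => d (k + 1) k, fun δ hδ => ?_, fun β hβ => ?_⟩
  · by_cases he : (fun k => d (k + 1) k) = δ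
    · exact Or.inr he
    · obtain ⟨k, hk, hne⟩ := exists_first he
      have := (key k δ hδ).2 fun j hj => (hk j hj).symm
      exact Or.inl ⟨k, hk, lt_of_le_of_ne ((hd (k + 1)).2 _ this) hne⟩
  · by_cases he : β = (fun k => d (k + 1) k)
    · exact Or.inr he
    · obtain ⟨k, hk, hne⟩ := exists_first he
      have hS' := hsub _ (hd (k + 1))
      have hag := (key (k + 1) _ hS').1 (hd (k + 1))
      refine Or.inl ⟨k, hk, ?_⟩
      rcases hβ _ hS' with ⟨m, hm, hlt⟩ | heq
      · rcases lt_trichotomy m k with h | rfl | h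
        · have h1 := hk m h
          have h2 := hag m (by omega)
          rw [h1, h2] at hlt
          exact absurd hlt (lt_irrefl _)
        · exact hlt
        · exact absurd (hm k h) hne
      · exact absurd (congrFun heq k) hne

def wcons {σ : ℕ} (c : Fin σ) (α : ℕ → Fin σ) : ℕ → Fin σ
  | 0 => c
  | k + 1 => α k

theorem wcons_tail {σ : ℕ} (α : ℕ → Fin σ) : wcons (α 0) (tail α) = α := by
  funext k; cases k <;> rfl

theorem wcons_le {σ : ℕ} (c : Fin σ) (α β : ℕ → Fin σ) (h : OmegaLe α β) :
    OmegaLe (wcons c α) (wcons c β) := by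
  rcases h with ⟨k, hk, hlt⟩ | rfl
  · refine Or.inl ⟨k + 1, fun j hj => ?_, hlt⟩
    cases j with
    | zero => rfl
    | succ j => exact hk j (by omega)
  · exact Or.inr rfl

theorem le_wcons {σ : ℕ} (c : Fin σ) (α β : ℕ → Fin σ) (h : OmegaLe α (wcons c β)) :
    α 0 < c ∨ (α 0 = c ∧ OmegaLe (tail α) β) := by
  rcases h with ⟨k, hk, hlt⟩ | rfl
  · cases k with
    | zero => exact Or.inl hlt
    | succ k =>
      exact Or.inr ⟨hk 0 (by omega), Or.inl ⟨k, fun j hj => hk (j + 1) (by omega), hlt⟩⟩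
  · exact Or.inr ⟨rfl, Or.inr rfl⟩

theorem Iset_nonempty {n σ : ℕ} (E : Set (Fin n × Fin n × Fin σ))
    (hE : ∀ u : Fin n, ∃ v c, (v, u, c) ∈ E) (u : Fin n) : (Iset E u).Nonempty := by
  choose p c h using hE
  refine ⟨fun i => c (p^[i] u), fun i => p^[i] u, rfl, fun i => ?_⟩
  simp only [Function.iterate_succ_apply']
  exact h _

theorem Iset_cons {n σ : ℕ} (E : Set (Fin n × Fin n × Fin σ)) {u v : Fin n} {c : Fin σ}
    (h : (v, u, c) ∈ E) {δ : ℕ → Fin σ} (hδ : δ ∈ Iset E v) : wcons c δ ∈ Iset E u := by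
  obtain ⟨f, rfl, hf⟩ := hδ
  refine ⟨fun i => Nat.casesOn i u f, rfl, fun i => ?_⟩
  cases i with
  | zero => exact h
  | succ i => exact hf i

/-- In a source-free labeled graph, the infimum string of a node `u` starts with a character
`γ 0` labeling an edge `(v, u, γ 0)` such that `tail γ` is the infimum string of `v`. -/
theorem stmt_4 (n σ : ℕ) [NeZero n] [NeZero σ]
    (E : Set (Fin n × Fin n × Fin σ))
    (hE : ∀ u : Fin n, ∃ v c, (v, u, c) ∈ E)
    (u : Fin n) (γ : ℕ → Fin σ) (hγ : IsGLBOmega (Iset E u) γ) :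
    ∃ v : Fin n, (v, u, γ 0) ∈ E ∧ IsGLBOmega (Iset E v) (tail γ) := by
  choose m hm using fun v => exists_glb _ (Iset_nonempty E hE v)
  obtain ⟨v₁, c₁, h₁⟩ := hE u
  obtain ⟨⟨v, c⟩, hvc, hmin⟩ := Set.exists_min_image {p : Fin n × Fin σ | (p.1, u, p.2) ∈ E}
    (fun p => toLex (wcons p.2 (m p.1))) (Set.toFinite _) ⟨(v₁, c₁), h₁⟩
  have hlow : ∀ δ ∈ Iset E u, OmegaLe (wcons c (m v)) δ := by
    rintro δ ⟨f, hf0, hf⟩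
    have he : (f 1, u, δ 0) ∈ E := hf0 ▸ hf 0
    have h1 := hmin (f 1, δ 0) he
    have h2 := wcons_le (δ 0) _ _
      ((hm (f 1)).1 (tail δ) ⟨fun i => f (i + 1), rfl, fun i => hf (i + 1)⟩)
    rw [wcons_tail, omegaLe_iff] at h2
    rw [omegaLe_iff]
    exact le_trans h1 h2
  have hγle : OmegaLe γ (wcons c (m v)) := by
    have hh : ∀ δ ∈ Iset E v, γ 0 < c ∨ (γ 0 = c ∧ OmegaLe (tail γ) δ) :=
      fun δ hδ => le_wcons _ _ _ (hγ.1 _ (Iset_cons E hvc hδ))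
    by_cases hlt : γ 0 < c
    · exact Or.inl ⟨0, fun j hj => absurd hj (by omega), hlt⟩
    · obtain ⟨δ, hδ⟩ := Iset_nonempty E hE v
      have h0 := ((hh δ hδ).resolve_left hlt).1
      have := wcons_le (γ 0) _ _
        ((hm v).2 (tail γ) fun δ hδ => ((hh δ hδ).resolve_left hlt).2)
      rw [wcons_tail] at this
      rwa [← h0]
  have heq : γ = wcons c (m v) := by
    have h2 := hγ.2 _ hlow
    rw [omegaLe_iff] at h2 hγle
    exact toLex.injective (le_antisymm hγle h2)
  subst heq
  exact ⟨v, hvc, hm v⟩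
end

section
/- Let (pred, lam) encode a deterministic labeled pseudoforest on Fin n over Fin σ for which the natural order on Fin n is a Wheeler order, and let (l, r, c) be a bridge. Let h, i : Fin n be nodes with pred h = l, lam h = c and pred i = r, lam i = c (such nodes exist by the bridge definition and are unique by determinism). Then (h : ℕ) + 1 = (i : ℕ), i.e., h is the immediate predecessor of i in the node order. (Converse direction of the bijection between bridges and pairs of order-consecutive nodes with equal incoming label.) -/
/-- Node `l` has an outgoing edge labeled `c` in the pseudoforest `(pred, lam)`. -/
def HasOut {n σ : ℕ} (pred : Fin n → Fin n) (lam : Fin n → Fin σ) (l : Fin n) (c : Fin σ) : Prop :=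
  ∃ w : Fin n, pred w = l ∧ lam w = c

/-- `(l, r, c)` is a bridge of the pseudoforest `(pred, lam)`. -/
def Bridge {n σ : ℕ} (pred : Fin n → Fin n) (lam : Fin n → Fin σ) (l r : Fin n) (c : Fin σ) : Prop :=
  l < r ∧ HasOut pred lam l c ∧ HasOut pred lam r c ∧
    ∀ k : Fin n, l < k → k < r → ¬ HasOut pred lam k c

/-- Converse direction of the bridge bijection: the two nodes reached from the endpoints
of a bridge by the `c`-labeled edges are order-consecutive. -/
theorem stmt_7 (n σ : ℕ) [NeZero n] [NeZero σ]
    (pred : Fin n → Fin n) (lam : Fin n → Fin σ)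
    (hdet : Function.Injective (fun u : Fin n => (pred u, lam u)))
    (hW2 : Monotone lam)
    (hW3 : ∀ u v : Fin n, u < v → lam u = lam v → pred u ≤ pred v)
    (l r : Fin n) (c : Fin σ) (hbr : Bridge pred lam l r c)
    (h i : Fin n)
    (hh1 : pred h = l) (hh2 : lam h = c)
    (hi1 : pred i = r) (hi2 : lam i = c) :
    (h : ℕ) + 1 = (i : ℕ) := by
  obtain ⟨hlr, -, -, hk⟩ := hbr
  subst hh1 hi1 hh2
  have hlt : h < i := by
    rcases lt_trichotomy h i with h1 | h1 | h1
    · exact h1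
    · subst h1; exact absurd hlr (lt_irrefl _)
    · exact absurd (hW3 i h h1 hi2) (not_le.mpr hlr)
  by_contra hne
  have hlt' : (h : ℕ) < (i : ℕ) := hlt
  have hin : (h : ℕ) + 1 < n := by omega
  obtain ⟨m, hm⟩ : ∃ m : Fin n, (m : ℕ) = (h : ℕ) + 1 := ⟨⟨(h : ℕ) + 1, hin⟩, rfl⟩
  have h1 : h < m := by rw [Fin.lt_def]; omega
  have h2 : m < i := by rw [Fin.lt_def]; omega
  have hl : lam m = lam h := le_antisymm (hi2 ▸ hW2 h2.le) (hW2 h1.le)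
  have p1 : pred h < pred m := by
    refine lt_of_le_of_ne (hW3 h m h1 hl.symm) fun e => h1.ne (hdet ?_)
    simp [e, hl]
  have p2 : pred m < pred i := by
    refine lt_of_le_of_ne (hW3 m i h2 (hl.trans hi2.symm)) fun e => h2.ne (hdet ?_)
    simp [e, hl, hi2]
  exact hk (pred m) p1 p2 ⟨m, rfl, hl⟩
end

section
/- Let (pred, lam) encode a labeled pseudoforest on Fin n over Fin σ for which the natural order on Fin n is a Wheeler order, and let str u be the backward string of node u (str u i = lam (pred^[i] u)). Then: (a) for all u ≤ v in Fin n, str u ≼ str v in the lexicographic order; (b) if moreover str is injective (all backward strings are pairwise distinct), then for all u, v : Fin n, u < v if and only if str u ≺ str v; i.e., the Wheeler order coincides with the lexicographic order of the nodes' incoming strings. -/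
/-- The Wheeler order of a pseudoforest coincides with the lexicographic order of the
nodes' backward strings (when those are pairwise distinct). -/
theorem stmt_9 (n σ : ℕ) [NeZero n] [NeZero σ]
    (pred : Fin n → Fin n) (lam : Fin n → Fin σ)
    (hW2 : Monotone lam)
    (hW3 : ∀ u v : Fin n, u < v → lam u = lam v → pred u ≤ pred v)
    (str : Fin n → ℕ → Fin σ)
    (hstr : ∀ (u : Fin n) (i : ℕ), str u i = lam (pred^[i] u)) :
    (∀ u v : Fin n, u ≤ v → OmegaLe (str u) (str v)) ∧
    (Function.Injective str →
      ∀ u v : Fin n, u < v ↔ OmegaLt (str u) (str v)) := by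
  have key : ∀ u v : Fin n, u ≤ v → ∀ k, (∀ j, j < k → str u j = str v j) →
      pred^[k] u ≤ pred^[k] v := by
    intro u v huv k
    induction k with
    | zero => intro _; simpa using huv
    | succ k ih =>
      intro h
      have h1 := ih (fun j hj => h j (by omega))
      have h2 := h k (by omega)
      rw [hstr, hstr] at h2
      rw [Function.iterate_succ_apply', Function.iterate_succ_apply']
      rcases h1.lt_or_eq with h3 | h3
      · exact hW3 _ _ h3 h2
      · rw [h3]
  have A : ∀ u v : Fin n, u ≤ v → OmegaLe (str u) (str v) := by
    intro u v huv
    by_cases he : str u = str v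
    · exact Or.inr he
    · left
      have hex : ∃ k, str u k ≠ str v k := Function.ne_iff.mp he
      classical
      have hmin : ∀ j, j < Nat.find hex → str u j = str v j :=
        fun j hj => not_not.mp (Nat.find_min hex hj)
      refine ⟨Nat.find hex, hmin, lt_of_le_of_ne ?_ (Nat.find_spec hex)⟩
      have h4 := hW2 (key u v huv _ hmin)
      rwa [← hstr, ← hstr] at h4
  refine ⟨A, fun hinj u v => ⟨fun h => ?_, fun h => ?_⟩⟩
  · exact (A u v h.le).resolve_right (fun e => h.ne (hinj e))
  · by_contra hn
    obtain ⟨k, hk, hlt⟩ := h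
    have h5 := hW2 (key v u (not_lt.mp hn) k (fun j hj => (hk j hj).symm))
    rw [← hstr, ← hstr] at h5
    exact absurd hlt (not_lt.mpr h5)
end

section
/- Let (pred, lam) encode a deterministic labeled pseudoforest on Fin n over Fin σ for which the natural order on Fin n is a Wheeler order, and suppose the backward strings str are pairwise distinct (str injective). Let (l, r, c) be a bridge and let i : Fin n satisfy 1 ≤ i, pred (i−1) = l, pred i = r and lam (i−1) = lam i = c. Then lcp(str (i−1), str i) = 1 + min { lcp(str (j−1), str j) : j : Fin n, l < j ≤ r }. (This is the LCP recurrence underlying the interval-stabbing LCP construction algorithm: the LCP entry generated by a bridge equals one plus the minimum LCP entry inside the bridge's interval.) -/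
theorem le_lcp_iff {σ : ℕ} {α β : ℕ → Fin σ} (h : α ≠ β) (k : ℕ) :
    k ≤ lcp α β ↔ ∀ j, j < k → α j = β j := by
  have hne : {k | α k ≠ β k}.Nonempty := Function.ne_iff.mp h
  constructor
  · intro hk j hj
    by_contra hcon
    have : lcp α β ≤ j := Nat.sInf_le hcon
    omega
  · intro hk
    by_contra hcon
    exact Nat.sInf_mem hne (hk _ (not_le.mp hcon))

/-- The LCP recurrence underlying the interval-stabbing algorithm: the LCP entry generated
by a bridge equals one plus the minimum LCP entry inside the bridge's interval. -/
theorem stmt_11 (n σ : ℕ) [NeZero n] [NeZero σ]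
    (pred : Fin n → Fin n) (lam : Fin n → Fin σ)
    (hdet : Function.Injective (fun u : Fin n => (pred u, lam u)))
    (hW2 : Monotone lam)
    (hW3 : ∀ u v : Fin n, u < v → lam u = lam v → pred u ≤ pred v)
    (str : Fin n → ℕ → Fin σ)
    (hstr : ∀ (u : Fin n) (i : ℕ), str u i = lam (pred^[i] u))
    (hinj : Function.Injective str)
    (l r : Fin n) (c : Fin σ) (hbr : Bridge pred lam l r c)
    (i : Fin n) (hi : 1 ≤ i)
    (hpl : pred (i - 1) = l) (hpr : pred i = r)
    (hc1 : lam (i - 1) = c) (hc2 : lam i = c) :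
    lcp (str (i - 1)) (str i) =
      1 + sInf {d : ℕ | ∃ j : Fin n, l < j ∧ j ≤ r ∧ d = lcp (str (j - 1)) (str j)} := by
  have hord : ∀ (k : ℕ) (u v : Fin n), u ≤ v → (∀ j, j < k → str u j = str v j) →
      pred^[k] u ≤ pred^[k] v := by
    intro k
    induction k with
    | zero => intro u v h _; simpa using h
    | succ k ih =>
      intro u v h ha
      have h1 := ih u v h (fun j hj => ha j (by omega))
      have h2 := ha k (by omega)
      rw [hstr, hstr] at h2
      rw [Function.iterate_succ_apply', Function.iterate_succ_apply']
      rcases h1.eq_or_lt with h3 | h3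
      · rw [h3]
      · exact hW3 _ _ h3 h2
  have hsand : ∀ (k : ℕ) (u w v : Fin n), u ≤ w → w ≤ v → (∀ j, j < k → str u j = str v j) →
      ∀ j, j < k → str u j = str w j := by
    intro k u w v huw hwv ha j
    induction j using Nat.strong_induction_on with
    | _ j ih =>
      intro hj
      have e1 : ∀ m, m < j → str u m = str w m := fun m hm => ih m hm (by omega)
      have e2 : ∀ m, m < j → str w m = str v m := fun m hm => by
        rw [← e1 m hm]; exact ha m (by omega)
      have h1 := hW2 (hord j u w huw e1)
      have h2 := hW2 (hord j w v hwv e2)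
      have h3 := ha j hj
      rw [← hstr, ← hstr] at h1 h2
      rw [← h3] at h2
      exact le_antisymm h1 h2
  have hlr := hbr.1
  have hii : str (i - 1) ≠ str i := fun h => by
    have := hinj h
    rw [this, hpr] at hpl
    exact hlr.ne hpl.symm
  have hval : ∀ j : Fin n, l < j → ((j - 1 : Fin n) : ℕ) = j - 1 ∧ 0 < (j : ℕ) := by
    intro j hj
    have h0 : j ≠ 0 := fun h => by
      rw [h] at hj; exact absurd hj (Fin.not_lt_zero l)
    have hp : 0 < (j : ℕ) := lt_of_le_of_lt (Nat.zero_le _) hj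
    exact ⟨Fin.val_sub_one_of_ne_zero h0, hp⟩
  have hjj : ∀ j : Fin n, l < j → str (j - 1) ≠ str j := fun j hj h => by
    have h1 := hinj h
    have h2 := hval j hj
    rw [h1] at h2
    omega
  have hA : lcp (str (i - 1)) (str i) = 1 + lcp (str l) (str r) := by
    have hs : ∀ u m, str u (m + 1) = str (pred u) m := fun u m => by
      rw [hstr, hstr, Function.iterate_succ_apply]
    apply eq_of_forall_le_iff
    intro k
    rw [le_lcp_iff hii]
    cases k with
    | zero => simp
    | succ k =>
      rw [Nat.add_comm 1, Nat.succ_le_succ_iff, le_lcp_iff (fun h => hlr.ne (hinj h))]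
      constructor
      · intro h j hj
        have := h (j + 1) (by omega)
        rwa [hs, hs, hpl, hpr] at this
      · intro h j hj
        cases j with
        | zero => rw [hstr, hstr]; simp [hc1, hc2]
        | succ j => rw [hs, hs, hpl, hpr]; exact h j (by omega)
  rw [hA]
  congr 1
  have hne : {d : ℕ | ∃ j : Fin n, l < j ∧ j ≤ r ∧ d = lcp (str (j - 1)) (str j)}.Nonempty :=
    ⟨_, r, hlr, le_rfl, rfl⟩
  apply eq_of_forall_le_iff
  intro k
  rw [le_lcp_iff (fun h => hlr.ne (hinj h)), le_csInf_iff (OrderBot.bddBelow _) hne]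
  constructor
  · rintro h d ⟨j, hj1, hj2, rfl⟩
    rw [le_lcp_iff (hjj j hj1)]
    intro m hm
    obtain ⟨h1, h2⟩ := hval j hj1
    have hj1' : (l : ℕ) < j := hj1
    have hj2' : (j : ℕ) ≤ r := hj2
    rw [← hsand k l j r hj1.le hj2 h m hm]
    refine (hsand k l (j - 1) r ?_ ?_ h m hm).symm
    · rw [Fin.le_def]; omega
    · rw [Fin.le_def]; omega
  · intro h
    have key : ∀ (x : ℕ) (j : Fin n), (j : ℕ) = l + x → j ≤ r →
        ∀ m, m < k → str l m = str j m := by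
      intro x
      induction x with
      | zero =>
        intro j hj _ m _
        have : j = l := Fin.ext (by omega)
        rw [this]
      | succ x ih =>
        intro j hj hjr m hm
        have hlj : l < j := by rw [Fin.lt_def]; omega
        obtain ⟨h1, h2⟩ := hval j hlj
        have hjr' : (j : ℕ) ≤ r := hjr
        rw [ih (j - 1) (by omega) (by rw [Fin.le_def]; omega) m hm]
        exact (le_lcp_iff (hjj j hlj) k).mp (h _ ⟨j, hlj, hjr, rfl⟩) m hm
    have hlr' : (l : ℕ) < r := hlr
    exact key (r - l) r (by omega) le_rfl
end

section
/- Let (pred, lam) encode a labeled pseudoforest on Fin n over Fin σ. If (l, r, c) and (l', r', c) are bridges carrying the same label c, and their half-open intervals intersect, i.e., there exists k : Fin n with l < k ≤ r and l' < k ≤ r', then l = l' and r = r'. (Two distinct bridges with the same label have disjoint intervals.) -/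
/-- Two bridges with the same label whose half-open intervals intersect coincide. -/
theorem stmt_12 (n σ : ℕ)
    (pred : Fin n → Fin n) (lam : Fin n → Fin σ)
    (l r l' r' : Fin n) (c : Fin σ)
    (hbr : Bridge pred lam l r c) (hbr' : Bridge pred lam l' r' c)
    (k : Fin n) (hk : l < k ∧ k ≤ r) (hk' : l' < k ∧ k ≤ r') :
    l = l' ∧ r = r' := by
  obtain ⟨_, hl, hr, h⟩ := hbr
  obtain ⟨_, hl', hr', h'⟩ := hbr'
  obtain ⟨a, b⟩ := hk
  obtain ⟨a', b'⟩ := hk'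
  constructor
  · rcases lt_trichotomy l l' with q | q | q
    · exact absurd hl' (h l' q (lt_of_lt_of_le a' b))
    · exact q
    · exact absurd hl (h' l q (lt_of_lt_of_le a b'))
  · rcases lt_trichotomy r r' with q | q | q
    · exact absurd hr (h' r (lt_of_lt_of_le a' b) q)
    · exact q
    · exact absurd hr' (h r' (lt_of_lt_of_le a b') q)
end
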